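/- For every integer k ≥ 1, the number of visits to y before returning to x has the distribution P_x(N = k) = (1/(deg(x) R(x,y))) · (1 − 1/(deg(y) R(x,y)))^{k−1} · (1/(deg(y) R(x,y))). -/

import Mathlib

open MeasureTheory Finset ENNReal

/-- The first return time to `x` of the trajectory `ω` (the least `n ≥ 1` with `ω n = x`;
by convention `sInf ∅ = 0`, which for the walks considered is an almost-surely irrelevant
convention since the walk on a finite connected graph returns almost surely). -/
noncomputable def firstReturn {V : Type*} [DecidableEq V] (x : V) (ω : ℕ → V) : ℕ :=
  sInf { n : ℕ | 1 ≤ n ∧ ω n = x }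

/-- The number of visits to `y` strictly before the first return to `x`. -/
noncomputable def visitsBeforeReturn {V : Type*} [DecidableEq V] (x y : V) (ω : ℕ → V) : ℕ :=
  ((Finset.range (firstReturn x ω)).filter fun n => 1 ≤ n ∧ ω n = y).card

/-- The one-step transition probability of the simple random walk on `G`: from `v`, jump to a
uniformly chosen neighbour of `v`. -/
noncomputable def srwStep {V : Type*} [Fintype V] (G : SimpleGraph V) [DecidableRel G.Adj]
    (v w : V) : ℝ≥0∞ :=
  if G.Adj v w then ((G.degree v : ℝ≥0∞))⁻¹ else 0

/-- The effective resistance between `x` and `y` in `G` with unit edge conductances: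
the reciprocal of the infimal Dirichlet energy `∑_{{u,v} ∈ E(G)} (f u - f v)²` over potentials
`f` with `f x = 0`, `f y = 1` (each edge is counted once, whence the factor `1/2` in the
double sum over ordered pairs). -/
noncomputable def graphResistance {V : Type*} [Fintype V] (G : SimpleGraph V)
    [DecidableRel G.Adj] (x y : V) : ℝ :=
  (sInf { E : ℝ | ∃ f : V → ℝ, f x = 0 ∧ f y = 1 ∧
    E = (1 / 2) * ∑ a : V, ∑ b : V, if G.Adj a b then (f a - f b) ^ 2 else 0 })⁻¹

section Paths

variable {V : Type*}

/-- The number of visits to `y` at the times `1, …, n`. -/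
noncomputable def visitCount [DecidableEq V] (y : V) (n : ℕ) (ω : ℕ → V) : ℕ :=
  ((Finset.range (n + 1)).filter fun i => 1 ≤ i ∧ ω i = y).card

/-- The trajectories that avoid `x` and visit `y` exactly `j` times at the times `1, …, n`. -/
def avoidWithVisits [DecidableEq V] (x y : V) (n j : ℕ) : Set (ℕ → V) :=
  { ω | (∀ i, 1 ≤ i → i ≤ n → ω i ≠ x) ∧ visitCount y n ω = j }

theorem visitCount_zero [DecidableEq V] (y : V) (ω : ℕ → V) : visitCount y 0 ω = 0 := by
  simp [visitCount]

theorem visitCount_succ [DecidableEq V] (y : V) (n : ℕ) (ω : ℕ → V) :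
    visitCount y (n + 1) ω = visitCount y n ω + if ω (n + 1) = y then 1 else 0 := by
  unfold visitCount
  rw [Finset.range_add_one (n := n + 1), Finset.filter_insert]
  split_ifs with h1 h2 h2
  · rw [Finset.card_insert_of_notMem (by simp)]
  · exact absurd h1.2 h2
  · exact absurd ⟨by omega, h2⟩ h1
  · rfl

theorem visitCount_mono [DecidableEq V] (y : V) (ω : ℕ → V) :
    Monotone fun n => visitCount y n ω :=
  monotone_nat_of_le_succ fun n => by simp [visitCount_succ]

theorem visitCount_congr [DecidableEq V] (y : V) {n : ℕ} {ω ω' : ℕ → V}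
    (h : ∀ i ≤ n, ω i = ω' i) : visitCount y n ω = visitCount y n ω' := by
  unfold visitCount
  congr 1
  refine Finset.filter_congr fun i hi => ?_
  rw [h i (by simpa [Nat.lt_succ_iff] using hi)]

theorem avoidWithVisits_congr [DecidableEq V] (x y : V) (n j : ℕ) {ω ω' : ℕ → V}
    (h : ∀ i ≤ n, ω i = ω' i) (hω : ω ∈ avoidWithVisits x y n j) :
    ω' ∈ avoidWithVisits x y n j :=
  ⟨fun i h1 h2 => h i h2 ▸ hω.1 i h1 h2, visitCount_congr y h ▸ hω.2⟩

theorem mem_avoidWithVisits_succ [DecidableEq V] (x y : V) (n j : ℕ) (ω : ℕ → V) :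
    ω ∈ avoidWithVisits x y (n + 1) j ↔
      (∀ i, 1 ≤ i → i ≤ n → ω i ≠ x) ∧ ω (n + 1) ≠ x ∧
        visitCount y n ω + (if ω (n + 1) = y then 1 else 0) = j := by
  rw [← visitCount_succ]
  constructor
  · rintro ⟨h, h'⟩
    exact ⟨fun i h1 h2 => h i h1 (by omega), h _ (by omega) le_rfl, h'⟩
  · rintro ⟨h, h1, h'⟩
    refine ⟨fun i hi1 hi2 => ?_, h'⟩
    rcases Nat.lt_or_ge n i with hi | hi
    · obtain rfl : i = n + 1 := by omega
      exact h1
    · exact h i hi1 hi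

theorem avoidWithVisits_succ_inter [DecidableEq V] {x y w : V} (hx : w ≠ x) (hy : w ≠ y)
    (n j : ℕ) :
    avoidWithVisits x y (n + 1) j ∩ { ω | ω (n + 1) = w } =
      avoidWithVisits x y n j ∩ { ω | ω (n + 1) = w } := by
  ext ω
  simp only [Set.mem_inter_iff, mem_avoidWithVisits_succ, Set.mem_ofPred_eq]
  constructor
  · rintro ⟨⟨h, -, h'⟩, rfl⟩
    exact ⟨⟨h, by simpa [hy] using h'⟩, rfl⟩
  · rintro ⟨⟨h, h'⟩, rfl⟩
    exact ⟨⟨h, hx, by simpa [hy] using h'⟩, rfl⟩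

theorem avoidWithVisits_succ_succ_inter [DecidableEq V] {x y : V} (hxy : x ≠ y)
    (n j : ℕ) :
    avoidWithVisits x y (n + 1) (j + 1) ∩ { ω | ω (n + 1) = y } =
      avoidWithVisits x y n j ∩ { ω | ω (n + 1) = y } := by
  ext ω
  simp only [Set.mem_inter_iff, mem_avoidWithVisits_succ, Set.mem_ofPred_eq]
  constructor
  · rintro ⟨⟨h, -, h'⟩, rfl⟩
    exact ⟨⟨h, by simpa using h'⟩, rfl⟩
  · rintro ⟨⟨h, h'⟩, rfl⟩
    exact ⟨⟨h, hxy.symm, by simpa using h'⟩, rfl⟩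

theorem disjoint_avoidWithVisits_return [DecidableEq V] (x y : V) (j : ℕ) :
    Pairwise (Function.onFun Disjoint
      fun n => avoidWithVisits x y n j ∩ { ω | ω (n + 1) = x }) := by
  refine (pairwise_disjoint_on _).2 fun m n hmn => ?_
  rw [Set.disjoint_left]
  rintro ω ⟨-, h⟩ ⟨⟨h', -⟩, -⟩
  exact h' (m + 1) (by omega) hmn h

theorem disjoint_avoidWithVisits_visit [DecidableEq V] (x y : V) (j : ℕ) :
    Pairwise (Function.onFun Disjoint
      fun n => avoidWithVisits x y n j ∩ { ω | ω (n + 1) = y }) := by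
  refine (pairwise_disjoint_on _).2 fun m n hmn => ?_
  rw [Set.disjoint_left]
  rintro ω ⟨⟨-, h1⟩, h2⟩ ⟨⟨-, h3⟩, -⟩
  have h4 := visitCount_succ y m ω
  have h5 : visitCount y (m + 1) ω ≤ visitCount y n ω := visitCount_mono y ω hmn
  rw [if_pos (by exact h2)] at h4
  omega

theorem setOf_visitsBeforeReturn_eq [DecidableEq V] (x y : V) {k : ℕ} (hk : 1 ≤ k) :
    { ω | visitsBeforeReturn x y ω = k } =
      ⋃ n, avoidWithVisits x y n k ∩ { ω | ω (n + 1) = x } := by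
  ext ω
  simp only [Set.mem_ofPred_eq, Set.mem_iUnion, Set.mem_inter_iff]
  constructor
  · intro h
    have hpos : firstReturn x ω ≠ 0 := by
      intro h0
      simp [visitsBeforeReturn, h0] at h
      omega
    have hne : { n : ℕ | 1 ≤ n ∧ ω n = x }.Nonempty := by
      by_contra hne
      rw [Set.not_nonempty_iff_eq_empty] at hne
      exact hpos (by simp [firstReturn, hne])
    obtain ⟨n, hn⟩ := Nat.exists_eq_succ_of_ne_zero hpos
    have hmem := Nat.sInf_mem hne
    change 1 ≤ firstReturn x ω ∧ ω (firstReturn x ω) = x at hmem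
    refine ⟨n, ⟨fun i h1 h2 h3 => ?_, ?_⟩, by rw [hn] at hmem; exact hmem.2⟩
    · have : firstReturn x ω ≤ i := Nat.sInf_le ⟨h1, h3⟩
      omega
    · rw [← h, visitsBeforeReturn, hn, visitCount]
  · rintro ⟨n, ⟨h1, h2⟩, h3⟩
    have : firstReturn x ω = n + 1 := by
      refine le_antisymm (Nat.sInf_le ⟨by omega, h3⟩) (le_csInf ⟨n + 1, by omega, h3⟩ ?_)
      rintro i ⟨hi, hi'⟩
      by_contra hlt
      exact h1 i hi (by omega) hi'
    rw [visitsBeforeReturn, this, ← h2, visitCount]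

end Paths

section Occupation

variable {V : Type*} [MeasurableSpace V]

theorem sum_measure_inter_preimage_singleton {β : Type*} [Fintype β] [MeasurableSpace β]
    [MeasurableSingletonClass β] (P : Measure (ℕ → V)) (Q : Set (ℕ → V)) {r : (ℕ → V) → β}
    (hr : Measurable r) : ∑ b, P (r ⁻¹' {b} ∩ Q) = P Q := by
  have h := sum_measure_preimage_singleton (μ := P.restrict Q) (f := r) Finset.univ
    fun b _ => hr (measurableSet_singleton b)
  simp only [Measure.restrict_apply (hr (measurableSet_singleton _))] at h
  simpa using h

variable [DecidableEq V]

/-- The expected number of times `n` at which the walk is at `v`, before returning to `x` and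
after exactly `j` visits to `y`. -/
noncomputable def occupation (P : Measure (ℕ → V)) (x y : V) (j : ℕ) (v : V) : ℝ≥0∞ :=
  ∑' n, P (avoidWithVisits x y n j ∩ { ω | ω n = v })

/-- The expected number of steps into `w` made before returning to `x` and after exactly `j`
visits to `y`. -/
noncomputable def flux (P : Measure (ℕ → V)) (x y : V) (j : ℕ) (w : V) : ℝ≥0∞ :=
  ∑' n, P (avoidWithVisits x y n j ∩ { ω | ω (n + 1) = w })

theorem occupation_eq (P : Measure (ℕ → V)) (x y : V) (j : ℕ) (v : V) :
    occupation P x y j v = P (avoidWithVisits x y 0 j ∩ { ω | ω 0 = v }) +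
      ∑' n, P (avoidWithVisits x y (n + 1) j ∩ { ω | ω (n + 1) = v }) :=
  tsum_eq_zero_add' ENNReal.summable

end Occupation

section Markov

variable {V : Type*} [Fintype V] [MeasurableSpace V] [DiscreteMeasurableSpace V]

theorem measurableSet_of_forall_le {Q : Set (ℕ → V)} (n : ℕ)
    (hQ : ∀ ω ω' : ℕ → V, (∀ i ≤ n, ω i = ω' i) → ω ∈ Q → ω' ∈ Q) : MeasurableSet Q := by
  let r : (ℕ → V) → (Fin (n + 1) → V) := fun ω i => ω i
  have hr : Measurable r := measurable_pi_lambda _ fun i => measurable_pi_apply _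
  have : Q = r ⁻¹' (r '' Q) := by
    refine (Set.subset_preimage_image r Q).antisymm ?_
    rintro ω ⟨ω', hω', h⟩
    exact hQ ω' ω (fun i hi => congrFun h ⟨i, by omega⟩) hω'
  rw [this]
  exact hr (Set.toFinite _).measurableSet

theorem measurableSet_avoidWithVisits_inter [DecidableEq V] (x y w : V) (n j : ℕ) :
    MeasurableSet (avoidWithVisits x y n j ∩ { ω | ω (n + 1) = w }) :=
  measurableSet_of_forall_le (n + 1) fun ω ω' h hω =>
    ⟨avoidWithVisits_congr x y n j (fun i hi => h i (by omega)) hω.1,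
      (h (n + 1) le_rfl).symm.trans hω.2⟩

variable (G : SimpleGraph V) [DecidableRel G.Adj] [DecidableEq V] {x : V} {P : Measure (ℕ → V)}

/-- The Markov property for an event `Q` determined by the coordinates up to time `n`. -/
theorem measure_inter_step
    (hP : ∀ (n : ℕ) (tr : ℕ → V),
      P { ω | ∀ i ≤ n, ω i = tr i } =
        if tr 0 = x then ∏ i ∈ Finset.range n, srwStep G (tr i) (tr (i + 1)) else 0)
    {Q : Set (ℕ → V)} (n : ℕ) (v w : V)
    (hQ : ∀ ω ω' : ℕ → V, (∀ i ≤ n, ω i = ω' i) → ω ∈ Q → ω' ∈ Q)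
    (hv : ∀ ω ∈ Q, ω n = v) :
    P (Q ∩ { ω | ω (n + 1) = w }) = P Q * srwStep G v w := by
  let r : (ℕ → V) → (Fin (n + 1) → V) := fun ω i => ω i
  have hr : Measurable r := measurable_pi_lambda _ fun i => measurable_pi_apply _
  rw [← sum_measure_inter_preimage_singleton P (Q ∩ _) hr,
    ← sum_measure_inter_preimage_singleton P Q hr, Finset.sum_mul]
  refine Finset.sum_congr rfl fun t _ => ?_
  let tr : ℕ → V := fun i => if h : i < n + 1 then t ⟨i, h⟩ else w
  have htr : ∀ ω, r ω = t ↔ ∀ i ≤ n, ω i = tr i := by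
    intro ω
    constructor
    · rintro rfl i hi
      simp [tr, r, hi]
    · intro h
      ext i
      rw [← Fin.eta i i.2]
      exact (h i (by omega)).trans (dif_pos i.2)
  have htr_last : tr (n + 1) = w := by simp [tr]
  by_cases hmem : tr ∈ Q
  · have h1 : r ⁻¹' {t} ∩ Q = { ω | ∀ i ≤ n, ω i = tr i } := by
      ext ω
      simp only [Set.mem_inter_iff, Set.mem_preimage, Set.mem_singleton_iff, htr,
        Set.mem_ofPred_eq, and_iff_left_iff_imp]
      exact fun h => hQ tr ω (fun i hi => (h i hi).symm) hmem
    have h2 : r ⁻¹' {t} ∩ (Q ∩ { ω | ω (n + 1) = w }) =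
        { ω | ∀ i ≤ n + 1, ω i = tr i } := by
      rw [← Set.inter_assoc, h1]
      ext ω
      simp only [Set.mem_inter_iff, Set.mem_ofPred_eq]
      constructor
      · rintro ⟨h, h'⟩ i hi
        rcases Nat.lt_or_ge n i with hi' | hi'
        · obtain rfl : i = n + 1 := by omega
          rw [h', htr_last]
        · exact h i hi'
      · intro h
        exact ⟨fun i hi => h i (by omega), (h _ le_rfl).trans htr_last⟩
    rw [h1, h2, hP, hP, Finset.prod_range_succ, htr_last, hv tr hmem]
    split_ifs <;> simp
  · have h1 : r ⁻¹' {t} ∩ Q = ∅ := by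
      rw [Set.eq_empty_iff_forall_notMem]
      rintro ω ⟨h, hω⟩
      exact hmem (hQ ω tr ((htr ω).1 h) hω)
    rw [← Set.inter_assoc, h1]
    simp

theorem flux_eq_sum
    (hP : ∀ (n : ℕ) (tr : ℕ → V),
      P { ω | ∀ i ≤ n, ω i = tr i } =
        if tr 0 = x then ∏ i ∈ Finset.range n, srwStep G (tr i) (tr (i + 1)) else 0)
    (y : V) (j : ℕ) (w : V) :
    flux P x y j w = ∑ v, occupation P x y j v * srwStep G v w := by
  simp only [occupation, ← ENNReal.tsum_mul_right]
  rw [← Summable.tsum_finsetSum fun _ _ => ENNReal.summable]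
  refine tsum_congr fun n => ?_
  rw [← sum_measure_inter_preimage_singleton P _ (measurable_pi_apply n)]
  refine Finset.sum_congr rfl fun v _ => ?_
  rw [← measure_inter_step G hP n v w]
  · congr 1
    ext ω
    simp only [Set.mem_inter_iff, Set.mem_preimage, Set.mem_singleton_iff, Set.mem_ofPred_eq]
    tauto
  · exact fun ω ω' h hω => ⟨avoidWithVisits_congr x y n j h hω.1, (h n le_rfl).symm.trans hω.2⟩
  · exact fun ω hω => hω.2

end Markov

section Network

variable {V : Type*} [Fintype V] (G : SimpleGraph V) [DecidableRel G.Adj]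

theorem sum_sum_adj_mul_sub (f g : V → ℝ) :
    (1 / 2) * ∑ a, ∑ b, (if G.Adj a b then (f a - f b) * (g a - g b) else 0) =
      ∑ a, f a * ∑ b, if G.Adj a b then g a - g b else 0 := by
  have h1 : ∑ a, f a * ∑ b, (if G.Adj a b then g a - g b else 0) =
      ∑ a, ∑ b, if G.Adj a b then f a * (g a - g b) else 0 := by
    simp only [Finset.mul_sum, mul_ite, mul_zero]
  have h2 : ∑ a, ∑ b, (if G.Adj a b then f a * (g a - g b) else 0) =
      ∑ a, ∑ b, if G.Adj a b then -(f b * (g a - g b)) else 0 := by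
    rw [Finset.sum_comm]
    refine Finset.sum_congr rfl fun a _ => Finset.sum_congr rfl fun b _ => ?_
    simp only [G.adj_comm b a]
    split_ifs <;> ring
  have h3 : ∑ a, ∑ b, (if G.Adj a b then (f a - f b) * (g a - g b) else 0) =
      ∑ a, ∑ b, (if G.Adj a b then f a * (g a - g b) else 0) +
      ∑ a, ∑ b, if G.Adj a b then -(f b * (g a - g b)) else 0 := by
    simp only [← Finset.sum_add_distrib]
    refine Finset.sum_congr rfl fun a _ => Finset.sum_congr rfl fun b _ => ?_
    split_ifs <;> ring
  rw [h3, ← h2, h1]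
  ring

theorem sum_adj_sub (g : V → ℝ) (a : V) :
    ∑ b, (if G.Adj a b then g a - g b else 0) =
      G.degree a * g a - ∑ b, if G.Adj a b then g b else 0 := by
  rw [← G.card_neighborFinset_eq_degree, G.neighborFinset_eq_filter, ← Finset.sum_filter,
    ← Finset.sum_filter, Finset.sum_sub_distrib, Finset.sum_const, nsmul_eq_mul]

theorem eq_zero_of_harmonic (hG : G.Connected) {x y : V} {g : V → ℝ}
    (hg : ∀ w, w ≠ x → w ≠ y → ∑ b, (if G.Adj w b then g w - g b else 0) = 0)
    (hx : g x = 0) (hy : g y = 0) (v : V) : g v = 0 := by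
  have h0 := sum_sum_adj_mul_sub G g g
  rw [Finset.sum_eq_zero (s := Finset.univ) (f := fun a => g a * _)] at h0
  swap
  · intro a _
    by_cases hax : a = x
    · simp [hax, hx]
    by_cases hay : a = y
    · simp [hay, hy]
    rw [hg a hax hay, mul_zero]
  have hnn : ∀ a b, 0 ≤ if G.Adj a b then (g a - g b) * (g a - g b) else 0 := by
    intro a b
    split_ifs
    · exact mul_self_nonneg _
    · exact le_rfl
  have hadj : ∀ a b, G.Adj a b → g a = g b := by
    intro a b hab
    have h1 := (Finset.sum_eq_zero_iff_of_nonneg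
      (fun a _ => Finset.sum_nonneg fun b _ => hnn a b)).1
        (by linarith : ∑ a, ∑ b, (if G.Adj a b then (g a - g b) * (g a - g b) else 0) = 0)
        a (Finset.mem_univ a)
    have h2 := (Finset.sum_eq_zero_iff_of_nonneg (fun b _ => hnn a b)).1 h1 b (Finset.mem_univ b)
    rw [if_pos hab, mul_self_eq_zero] at h2
    linarith
  obtain ⟨p⟩ := hG.preconnected v x
  induction p with
  | nil => exact hx
  | cons h _ ih => exact (hadj _ _ h).trans (ih hg hx)

/-- The current out of `y` under the unit voltage `h` is the effective conductance. -/
theorem inv_graphResistance_eq {x y : V} {h : V → ℝ}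
    (hh : ∀ w, w ≠ x → w ≠ y → ∑ b, (if G.Adj w b then h w - h b else 0) = 0)
    (hx : h x = 0) (hy : h y = 1) :
    (graphResistance G x y)⁻¹ = ∑ b, if G.Adj y b then h y - h b else 0 := by
  classical
  have hpair : ∀ f : V → ℝ, f x = 0 → f y = 1 →
      (1 / 2) * ∑ a, ∑ b, (if G.Adj a b then (f a - f b) * (h a - h b) else 0) =
        ∑ b, if G.Adj y b then h y - h b else 0 := by
    intro f hfx hfy
    rw [sum_sum_adj_mul_sub, Finset.sum_eq_single y, hfy, one_mul]
    · intro a _ hay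
      by_cases hax : a = x
      · simp [hax, hfx]
      · rw [hh a hax hay, mul_zero]
    · simp
  rw [graphResistance, inv_inv]
  refine IsLeast.csInf_eq ⟨⟨h, hx, hy, ?_⟩, ?_⟩
  · rw [← hpair h hx hy]
    simp only [pow_two]
  · rintro _ ⟨f, hfx, hfy, rfl⟩
    have h1 := hpair f hfx hfy
    have h2 := hpair h hx hy
    have h3 : 0 ≤ ∑ a, ∑ b, if G.Adj a b then ((f a - f b) - (h a - h b)) ^ 2 else 0 :=
      Finset.sum_nonneg fun a _ => Finset.sum_nonneg fun b _ => by
        split_ifs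
        · exact sq_nonneg _
        · exact le_rfl
    have h4 : ∑ a, ∑ b, (if G.Adj a b then ((f a - f b) - (h a - h b)) ^ 2 else 0) =
        ∑ a, ∑ b, (if G.Adj a b then (f a - f b) ^ 2 else 0) -
        2 * ∑ a, ∑ b, (if G.Adj a b then (f a - f b) * (h a - h b) else 0) +
        ∑ a, ∑ b, (if G.Adj a b then (h a - h b) * (h a - h b) else 0) := by
      simp only [Finset.mul_sum, ← Finset.sum_add_distrib, ← Finset.sum_sub_distrib]
      refine Finset.sum_congr rfl fun a _ => Finset.sum_congr rfl fun b _ => ?_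
      split_ifs <;> ring
    linarith

/-- A sequence of functions, harmonic off `x` and `y`, in which the flux of each into `y` feeds
the next one. -/
theorem sum_adj_eq_of_harmonic_seq (hG : G.Connected) {x y : V} (hxy : x ≠ y)
    (hdx : (G.degree x : ℝ) ≠ 0) (hdy : (G.degree y : ℝ) ≠ 0) {g : ℕ → V → ℝ}
    (hg : ∀ j w, w ≠ x → w ≠ y → G.degree w * g j w = ∑ b, if G.Adj w b then g j b else 0)
    (h0x : G.degree x * g 0 x = 1) (h0y : g 0 y = 0) (hsx : ∀ j, g (j + 1) x = 0)
    (hsy : ∀ j, G.degree y * g (j + 1) y = ∑ b, if G.Adj y b then g j b else 0) (k : ℕ) :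
    ∑ b, (if G.Adj x b then g (k + 1) b else 0) =
      (1 / ((G.degree x : ℝ) * graphResistance G x y)) *
        (1 - 1 / ((G.degree y : ℝ) * graphResistance G x y)) ^ k *
        (1 / ((G.degree y : ℝ) * graphResistance G x y)) := by
  set C := (graphResistance G x y)⁻¹ with hC
  let h : V → ℝ := fun v => 1 - G.degree x * g 0 v
  have hx : h x = 0 := by simp [h, h0x]
  have hy : h y = 1 := by simp [h, h0y]
  have hh_sum : ∀ a, ∑ b, (if G.Adj a b then h a - h b else 0) =
      -(G.degree x * (G.degree a * g 0 a - ∑ b, if G.Adj a b then g 0 b else 0)) := by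
    intro a
    rw [← sum_adj_sub, Finset.mul_sum, ← Finset.sum_neg_distrib]
    refine Finset.sum_congr rfl fun b _ => ?_
    simp only [h]
    split_ifs <;> ring
  have hh : ∀ w, w ≠ x → w ≠ y → ∑ b, (if G.Adj w b then h w - h b else 0) = 0 := by
    intro w hwx hwy
    rw [hh_sum, hg 0 w hwx hwy]
    ring
  have hCy : C = ∑ b, if G.Adj y b then h y - h b else 0 :=
    inv_graphResistance_eq G hh hx hy
  have hCx : ∑ b, (if G.Adj x b then h b else 0) = C := by
    have h1 := sum_sum_adj_mul_sub G (fun _ => 1) h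
    simp only [sub_self, zero_mul, ite_self, Finset.sum_const_zero, mul_zero, one_mul] at h1
    classical
    rw [← Finset.add_sum_erase _ _ (Finset.mem_univ x), sum_adj_sub, hx,
      ← Finset.add_sum_erase _ _ (Finset.mem_erase.2 ⟨hxy.symm, Finset.mem_univ y⟩),
      ← hCy, Finset.sum_eq_zero (s := (Finset.univ.erase x).erase y)] at h1
    · linarith
    · intro w hw
      simp only [Finset.mem_erase, Finset.mem_univ, and_true] at hw
      exact hh w hw.2 hw.1
  have hSy : ∑ b, (if G.Adj y b then h b else 0) = G.degree y - C := by
    rw [hCy, sum_adj_sub, hy]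
    ring
  have hprop : ∀ j v, g (j + 1) v = g (j + 1) y * h v := by
    intro j v
    have := eq_zero_of_harmonic G hG (x := x) (y := y)
      (g := fun v => g (j + 1) v - g (j + 1) y * h v) (fun w hwx hwy => ?_)
      (by simp [hsx, hx]) (by simp [hy]) v
    · linarith
    · have h1 := sum_adj_sub G (g (j + 1)) w
      rw [hg _ w hwx hwy, sub_self] at h1
      have h2 : ∑ b, (if G.Adj w b then
          (g (j + 1) w - g (j + 1) y * h w) - (g (j + 1) b - g (j + 1) y * h b) else 0) =
          ∑ b, (if G.Adj w b then g (j + 1) w - g (j + 1) b else 0) -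
          g (j + 1) y * ∑ b, (if G.Adj w b then h w - h b else 0) := by
        rw [Finset.mul_sum, ← Finset.sum_sub_distrib]
        refine Finset.sum_congr rfl fun b _ => ?_
        split_ifs <;> ring
      rw [h2, h1, hh w hwx hwy]
      ring
  have hsum : ∀ j a, ∑ b, (if G.Adj a b then g (j + 1) b else 0) =
      g (j + 1) y * ∑ b, if G.Adj a b then h b else 0 := by
    intro j a
    rw [Finset.mul_sum]
    refine Finset.sum_congr rfl fun b _ => ?_
    rw [mul_ite, mul_zero, ← hprop]
  have hval : ∀ j, g (j + 1) y = C / G.degree x / G.degree y * (1 - C / G.degree y) ^ j := by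
    intro j
    induction j with
    | zero =>
      have h1 := hsy 0
      have h2 := hh_sum y
      rw [← hCy, h0y, ← h1] at h2
      rw [h2]
      field_simp
      ring
    | succ j ih =>
      have h1 := hsy (j + 1)
      rw [hsum, hSy, ih] at h1
      rw [pow_succ, ← mul_left_cancel_iff_of_pos (lt_of_le_of_ne (Nat.cast_nonneg _) hdy.symm), h1]
      field_simp
  rw [hsum, hCx, hval, one_div, one_div, mul_inv, mul_inv, ← hC]
  ring

end Network

/-- For the simple random walk on a finite connected graph started at `x`, the number `N` of
visits to `y ≠ x` before the first return to `x` satisfies, for every integer `k ≥ 1`,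
`P_x(N = k) = (deg(x) R(x,y))⁻¹ (1 − (deg(y) R(x,y))⁻¹)^{k−1} (deg(y) R(x,y))⁻¹`. -/
theorem visits_before_return_distribution {V : Type*} [Fintype V] [DecidableEq V]
    [MeasurableSpace V] [DiscreteMeasurableSpace V]
    (G : SimpleGraph V) [DecidableRel G.Adj] (hG : G.Connected)
    (x y : V) (hxy : x ≠ y)
    (P : Measure (ℕ → V)) [IsProbabilityMeasure P]
    (hP : ∀ (n : ℕ) (tr : ℕ → V),
      P { ω | ∀ i ≤ n, ω i = tr i } =
        if tr 0 = x then ∏ i ∈ Finset.range n, srwStep G (tr i) (tr (i + 1)) else 0)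
    (k : ℕ) (hk : 1 ≤ k) :
    P { ω | visitsBeforeReturn x y ω = k } =
      ENNReal.ofReal
        ((1 / ((G.degree x : ℝ) * graphResistance G x y)) *
          (1 - 1 / ((G.degree y : ℝ) * graphResistance G x y)) ^ (k - 1) *
          (1 / ((G.degree y : ℝ) * graphResistance G x y))) := by
  classical
  obtain ⟨k, rfl⟩ : ∃ m, k = m + 1 := ⟨k - 1, by omega⟩
  have : Nontrivial V := ⟨x, y, hxy⟩
  have hdeg : ∀ v, (G.degree v : ℝ) ≠ 0 := fun v =>
    Nat.cast_ne_zero.2 (hG.preconnected.degree_pos_of_nontrivial v).ne'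
  have hdeg' : ∀ v, (G.degree v : ℝ≥0∞) ≠ 0 := fun v =>
    Nat.cast_ne_zero.2 (hG.preconnected.degree_pos_of_nontrivial v).ne'
  have hstart : ∀ v, P { ω | ω 0 = v } = if v = x then 1 else 0 := by
    intro v
    simpa using hP 0 fun _ => v
  have hstart_succ : ∀ j v, P (avoidWithVisits x y 0 (j + 1) ∩ { ω | ω 0 = v }) = 0 := by
    intro j v
    have : avoidWithVisits x y 0 (j + 1) = ∅ :=
      Set.eq_empty_iff_forall_notMem.2 fun ω hω => by simpa [visitCount_zero] using hω.2
    simp [this]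
  have hstart_ne : ∀ j v, v ≠ x → P (avoidWithVisits x y 0 j ∩ { ω | ω 0 = v }) = 0 :=
    fun j v hv => measure_mono_null Set.inter_subset_right (by rw [hstart, if_neg hv])
  have hocc : ∀ j w, w ≠ x → w ≠ y → occupation P x y j w = flux P x y j w := by
    intro j w hwx hwy
    simp only [occupation_eq, hstart_ne j w hwx, zero_add, avoidWithVisits_succ_inter hwx hwy,
      flux]
  have hocc_y : ∀ j, occupation P x y (j + 1) y = flux P x y j y := by
    intro j
    simp only [occupation_eq, hstart_ne _ y hxy.symm, zero_add,
      avoidWithVisits_succ_succ_inter hxy, flux]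
  have hreturn : ∀ n j, avoidWithVisits x y (n + 1) j ∩ { ω | ω (n + 1) = x } = ∅ :=
    fun n j => Set.eq_empty_iff_forall_notMem.2 fun ω hω => hω.1.1 _ (by omega) le_rfl hω.2
  have hocc_x : ∀ j, occupation P x y (j + 1) x = 0 := by
    intro j
    simp [occupation_eq, hstart_succ, hreturn]
  have hocc_zero_x : occupation P x y 0 x = 1 := by
    have : avoidWithVisits x y 0 0 = Set.univ :=
      Set.eq_univ_of_forall fun ω => ⟨fun i h1 h2 => by omega, visitCount_zero y ω⟩
    simp [occupation_eq, hreturn, this, hstart]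
  have hocc_zero_y : occupation P x y 0 y = 0 := by
    have : ∀ n, avoidWithVisits x y (n + 1) 0 ∩ { ω | ω (n + 1) = y } = ∅ := fun n =>
      Set.eq_empty_iff_forall_notMem.2 fun ω hω => by
        have h1 := hω.1.2
        rw [visitCount_succ, if_pos (by exact hω.2)] at h1
        omega
    simp [occupation_eq, hstart_ne _ y hxy.symm, this]
  have hflux_x : ∀ j, flux P x y j x =
      P (⋃ n, avoidWithVisits x y n j ∩ { ω | ω (n + 1) = x }) := fun j =>
    (measure_iUnion (disjoint_avoidWithVisits_return x y j)
      fun n => measurableSet_avoidWithVisits_inter x y x n j).symm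
  have hflux_y : ∀ j, flux P x y j y =
      P (⋃ n, avoidWithVisits x y n j ∩ { ω | ω (n + 1) = y }) := fun j =>
    (measure_iUnion (disjoint_avoidWithVisits_visit x y j)
      fun n => measurableSet_avoidWithVisits_inter x y y n j).symm
  have hstep : ∀ v w, srwStep G v w ≠ ⊤ := by
    intro v w
    unfold srwStep
    split_ifs
    · exact ENNReal.inv_ne_top.2 (hdeg' v)
    · exact ENNReal.zero_ne_top
  have hfin_adj : ∀ j w v, G.Adj w v → occupation P x y j w ≠ ⊤ → occupation P x y j v ≠ ⊤ := by
    intro j w v hwv hw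
    have hfl : flux P x y j w ≠ ⊤ := by
      by_cases hwx : w = x
      · rw [hwx, hflux_x]
        exact measure_ne_top _ _
      by_cases hwy : w = y
      · rw [hwy, hflux_y]
        exact measure_ne_top _ _
      rwa [← hocc j w hwx hwy]
    intro hv
    rw [flux_eq_sum G hP] at hfl
    refine hfl (ENNReal.sum_eq_top.2 ⟨v, Finset.mem_univ v, ?_⟩)
    rw [hv, srwStep, if_pos hwv.symm]
    exact ENNReal.top_mul (ENNReal.inv_ne_zero.2 (ENNReal.natCast_ne_top _))
  have hfin : ∀ j v, occupation P x y j v ≠ ⊤ := by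
    intro j v
    have hx : occupation P x y j x ≠ ⊤ := by
      cases j with
      | zero => simp [hocc_zero_x]
      | succ j => simp [hocc_x]
    have hreach : ∀ u, G.Walk u v → occupation P x y j u ≠ ⊤ → occupation P x y j v ≠ ⊤ := by
      intro u p
      induction p with
      | nil => exact id
      | cons h _ ih => exact fun hu => ih (hfin_adj j _ _ h hu)
    obtain ⟨p⟩ := hG.preconnected x v
    exact hreach x p hx
  let g : ℕ → V → ℝ := fun j v => (occupation P x y j v).toReal / G.degree v
  have hdeg_mul : ∀ j v, G.degree v * g j v = (occupation P x y j v).toReal := fun j v =>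
    mul_div_cancel₀ _ (hdeg v)
  have hflux : ∀ j w, (flux P x y j w).toReal = ∑ b, if G.Adj w b then g j b else 0 := by
    intro j w
    rw [flux_eq_sum G hP, ENNReal.toReal_sum fun v _ => ENNReal.mul_ne_top (hfin j v) (hstep v w)]
    refine Finset.sum_congr rfl fun v _ => ?_
    simp only [ENNReal.toReal_mul, srwStep, G.adj_comm w v]
    split_ifs <;> simp [g, div_eq_mul_inv]
  have key := sum_adj_eq_of_harmonic_seq G hG hxy (hdeg x) (hdeg y) (g := g)
    (fun j w hwx hwy => by rw [hdeg_mul, hocc j w hwx hwy, hflux])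
    (by simp [hdeg_mul, hocc_zero_x]) (by simp [g, hocc_zero_y]) (fun j => by simp [g, hocc_x])
    (fun j => by rw [hdeg_mul, hocc_y, hflux]) k
  rw [Nat.add_sub_cancel, ← key, ← hflux, hflux_x, ← setOf_visitsBeforeReturn_eq x y hk,
    ENNReal.ofReal_toReal (measure_ne_top _ _)]
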